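/- Let X be a Noetherian space and let (F_i)_{i ∈ I} be a family of closed subsets of X that is cofinal, in the sense that every proper closed subset of X is included in some F_i. Then ||X|| ≤ sup_{i ∈ I} (||F_i|| + 1), where ||F_i|| is the stature of F_i as a topological subspace of X; moreover equality holds if every F_i is a proper subset of X. -/

import Mathlib

open TopologicalSpace

/-- The ordinal rank of an element of a poset: defined by well-founded recursion as the least
ordinal strictly greater than the ranks of all strictly smaller elements (and `0` as a junk
value if the strict order is not well-founded). -/
noncomputable def wfRank {α : Type*} [Preorder α] (a : α) : Ordinal :=
  open Classical in
  if h : WellFoundedLT α then @IsWellFounded.rank α (· < ·) h a else 0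

/-- The ordinal rank of a poset: the least ordinal strictly greater than the ranks of
all its elements. -/
noncomputable def ordRank (α : Type*) [Preorder α] : Ordinal :=
  ⨆ a : α, wfRank a + 1

/-- The stature of a topological space: the rank of the whole space in the poset of
closed subsets ordered by inclusion (equivalently, the ordinal rank of the poset of proper
closed subsets). -/
noncomputable def stature (X : Type*) [TopologicalSpace X] : Ordinal :=
  wfRank (⊤ : Closeds X)

/-- The sobrification rank of a topological space: the ordinal rank of the poset of
irreducible closed subsets ordered by inclusion. -/
noncomputable def sobRank (X : Type*) [TopologicalSpace X] : Ordinal :=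
  ordRank (IrreducibleCloseds X)

theorem wfRank_eq_rank {α : Type*} [Preorder α] [h : WellFoundedLT α] (a : α) :
    wfRank a = IsWellFounded.rank (α := α) (· < ·) a :=
  dif_pos h

theorem wfRank_strictMono {α : Type*} [Preorder α] [WellFoundedLT α] :
    StrictMono (wfRank : α → Ordinal) := fun a b hab => by
  rw [wfRank_eq_rank, wfRank_eq_rank]
  exact WellFoundedLT.rank_strictMono hab

theorem wfRank_mono {α : Type*} [PartialOrder α] [WellFoundedLT α] :
    Monotone (wfRank : α → Ordinal) :=
  wfRank_strictMono.monotone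

theorem wfRank_le_iff {α : Type*} [Preorder α] [WellFoundedLT α] {a : α} {o : Ordinal} :
    wfRank a ≤ o ↔ ∀ b < a, wfRank b < o := by
  simp only [wfRank_eq_rank]
  rw [IsWellFounded.rank_eq, Ordinal.iSup_le_iff]
  simp

/-- An order embedding onto a lower set preserves the rank. -/
theorem wfRank_apply_eq {α β : Type u} [PartialOrder α] [PartialOrder β] [WellFoundedLT α]
    [WellFoundedLT β] (f : α ↪o β) (hf : IsLowerSet (Set.range f)) (a : α) :
    wfRank (f a) = wfRank a := by
  induction a using WellFoundedLT.induction with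
  | ind a ih =>
    apply le_antisymm
    · refine wfRank_le_iff.2 fun b hb => ?_
      obtain ⟨a', rfl⟩ := hf hb.le ⟨a, rfl⟩
      have ha' := f.lt_iff_lt.1 hb
      rw [ih a' ha']
      exact wfRank_strictMono ha'
    · refine wfRank_le_iff.2 fun a' ha' => ?_
      rw [← ih a' ha']
      exact wfRank_strictMono (f.strictMono ha')

/-- The stature of a closed subspace is its rank among the closed subsets of the whole space. -/
theorem stature_coe_closeds {X : Type u} [TopologicalSpace X] [NoetherianSpace X]
    (F : Closeds X) : stature ↥(F : Set X) = wfRank F := by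
  let f : Closeds ↥(F : Set X) ↪o Closeds X := OrderEmbedding.ofMapLEIff
    (fun C => ⟨Subtype.val '' (C : Set ↥(F : Set X)),
      F.isClosed.isClosedMap_subtype_val _ C.isClosed⟩)
    (fun _ _ => Set.image_subset_image_iff Subtype.val_injective)
  have hf : IsLowerSet (Set.range f) := by
    rintro _ G hG ⟨C, rfl⟩
    have hGF : (G : Set X) ⊆ F := fun x hx => Subtype.coe_image_subset _ _ (hG hx)
    exact ⟨⟨Subtype.val ⁻¹' (G : Set X), G.isClosed.preimage continuous_subtype_val⟩,
      SetLike.coe_injective ((Subtype.image_preimage_val _ _).trans (Set.inter_eq_right.2 hGF))⟩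
  have htop : f ⊤ = F := SetLike.coe_injective (Set.image_univ.trans Subtype.range_val)
  rw [stature, ← wfRank_apply_eq f hf, htop]

/-- Let `X` be Noetherian and `(F i)` a family of closed subsets of `X` such that every
proper closed subset of `X` is included in some `F i`. Then
`‖X‖ ≤ ⨆ i, (‖F i‖ + 1)`, where `‖F i‖` is the stature of the subspace `F i`; and equality
holds if every `F i` is proper. -/
theorem stature_of_cofinal_closeds (X : Type u) [TopologicalSpace X] [NoetherianSpace X]
    {I : Type u} (F : I → Closeds X)
    (hcof : ∀ G : Closeds X, G ≠ ⊤ → ∃ i, G ≤ F i) :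
    stature X ≤ (⨆ i, stature ↥(F i : Set X) + 1) ∧
    ((∀ i, F i ≠ ⊤) → stature X = ⨆ i, stature ↥(F i : Set X) + 1) := by
  simp only [stature_coe_closeds]
  have hle : stature X ≤ ⨆ i, wfRank (F i) + 1 := by
    refine wfRank_le_iff.2 fun G hG => ?_
    obtain ⟨i, hi⟩ := hcof G hG.ne
    exact (Order.lt_add_one_iff.2 (wfRank_mono hi)).trans_le
      (Ordinal.le_iSup (fun i => wfRank (F i) + 1) i)
  refine ⟨hle, fun hF => hle.antisymm (Ordinal.iSup_le fun i => ?_)⟩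
  exact Order.add_one_le_of_lt (wfRank_strictMono (hF i).lt_top)
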